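/- Let W be a simple finite-dimensional associative triple system of the second kind over a field F of characteristic different from 2, and let (A(W), φ, Γ(W)) be its Loos envelope with its canonical involution φ and 3-grading Γ(W). Then the morphism of affine group schemes θ: Aut(W,{·,·,·}) → Aut(A(W), φ, Γ(W)), defined on R-points (R a unital commutative associative F-algebra) by sending ψ ∈ Aut_R(W⊗R, {·,·,·}_R) to its unique extension A(ψ) to an automorphism of (A(W)⊗R, φ_R, Γ(W)_R), is an isomorphism of affine group schemes, with inverse given on R-points by restricting an automorphism to the degree −1 homogeneous component A(W)_{−1}⊗R = W⊗R. -/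

import Mathlib

open scoped TensorProduct

/-- The products `j x * φ (j y)`, spanning the left half of the degree-zero component. -/
def leftProducts {R B M : Type*} [CommRing R] [Ring B] [Algebra R B] [AddCommGroup M] [Module R M]
    (φ : B →ₗ[R] B) (j : M →ₗ[R] B) : Set B :=
  {b | ∃ x y, j x * φ (j y) = b}

/-- The products `φ (j x) * j y`, spanning the right half of the degree-zero component. -/
def rightProducts {R B M : Type*} [CommRing R] [Ring B] [Algebra R B] [AddCommGroup M] [Module R M]
    (φ : B →ₗ[R] B) (j : M →ₗ[R] B) : Set B :=
  {b | ∃ x y, φ (j x) * j y = b}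

/-- `B` is an algebra with involution `φ`, spanned by `j M`, `φ (j M)` and their products, with
`e` an idempotent whose Peirce decomposition separates these four pieces, and the embedding `j`
carries `T` to the triple product `x * φ y * z`. -/
structure IsTripleEnvelope {R B M : Type*} [CommRing R] [Ring B] [Algebra R B] [AddCommGroup M]
    [Module R M] (φ : B →ₗ[R] B) (j : M →ₗ[R] B) (T : M →ₗ[R] M →ₗ[R] M →ₗ[R] M) (e : B) :
    Prop where
  invol : ∀ a, φ (φ a) = a
  anti : ∀ a b, φ (a * b) = φ b * φ a
  inj : Function.Injective j
  triple : ∀ x y z, j (T x y z) = j x * φ (j y) * j z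
  mul_zero : ∀ x y, j x * j y = 0
  e_mul : ∀ x, e * j x = j x
  mul_e : ∀ x, j x * e = 0
  e_mul_star : ∀ x, e * φ (j x) = 0
  star_mul_e : ∀ x, φ (j x) * e = φ (j x)
  e_mem : e ∈ Submodule.span R (leftProducts φ j)
  compl_mem : 1 - e ∈ Submodule.span R (rightProducts φ j)
  span_top : Submodule.span R
    (Set.range j ∪ Set.range (fun x => φ (j x)) ∪ leftProducts φ j ∪ rightProducts φ j) = ⊤

namespace IsTripleEnvelope

section General

variable {R B M : Type*} [CommRing R] [Ring B] [Algebra R B] [AddCommGroup M] [Module R M]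
  {φ : B →ₗ[R] B} {j : M →ₗ[R] B} {T : M →ₗ[R] M →ₗ[R] M →ₗ[R] M} {e : B}

theorem star_mul_star (h : IsTripleEnvelope φ j T e) (x y : M) : φ (j x) * φ (j y) = 0 := by
  rw [← h.anti, h.mul_zero, map_zero]

theorem star_triple (h : IsTripleEnvelope φ j T e) (x y z : M) :
    φ (j (T x y z)) = φ (j z) * j y * φ (j x) := by
  rw [h.triple, h.anti, h.anti, h.invol, mul_assoc]

theorem induction (h : IsTripleEnvelope φ j T e) {p : B → Prop}
    (hj : ∀ x, p (j x)) (hs : ∀ x, p (φ (j x))) (hl : ∀ x y, p (j x * φ (j y)))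
    (hr : ∀ x y, p (φ (j x) * j y)) (hadd : ∀ a b, p a → p b → p (a + b))
    (hsmul : ∀ (c : R) a, p a → p (c • a)) (b : B) : p b := by
  have hb : b ∈ Submodule.span R
    (Set.range j ∪ Set.range (fun x => φ (j x)) ∪ leftProducts φ j ∪ rightProducts φ j) :=
    h.span_top ▸ Submodule.mem_top
  induction hb using Submodule.span_induction with
  | mem b hb =>
    rcases hb with ((⟨x, rfl⟩ | ⟨x, rfl⟩) | ⟨x, y, rfl⟩) | ⟨x, y, rfl⟩
    exacts [hj x, hs x, hl x y, hr x y]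
  | zero => simpa using hj 0
  | add a b _ _ ha hb => exact hadd a b ha hb
  | smul c a _ ha => exact hsmul c a ha

theorem algHom_ext (h : IsTripleEnvelope φ j T e) {f g : B →ₐ[R] B}
    (hf : ∀ b, f (φ b) = φ (f b)) (hg : ∀ b, g (φ b) = φ (g b))
    (hfg : ∀ x, f (j x) = g (j x)) : f = g := by
  ext b
  induction b using h.induction with
  | hj x => exact hfg x
  | hs x => rw [hf, hg, hfg]
  | hl x y => rw [map_mul, map_mul, hf, hg, hfg, hfg]
  | hr x y => rw [map_mul, map_mul, hf, hg, hfg, hfg]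
  | hadd a b ha hb => rw [map_add, map_add, ha, hb]
  | hsmul c a ha => rw [map_smul, map_smul, ha]

/-- The linear map `x ⊗ y ↦ j x * φ (j y)`. -/
def leftMul (φ : B →ₗ[R] B) (j : M →ₗ[R] B) : M ⊗[R] M →ₗ[R] B :=
  TensorProduct.lift ((LinearMap.mul R B).compl₁₂ j (φ ∘ₗ j))

/-- The linear map `x ⊗ y ↦ φ (j x) * j y`. -/
def rightMul (φ : B →ₗ[R] B) (j : M →ₗ[R] B) : M ⊗[R] M →ₗ[R] B :=
  TensorProduct.lift ((LinearMap.mul R B).compl₁₂ (φ ∘ₗ j) j)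

@[simp]
theorem leftMul_tmul (x y : M) : leftMul φ j (x ⊗ₜ y) = j x * φ (j y) := by
  simp [leftMul]

@[simp]
theorem rightMul_tmul (x y : M) : rightMul φ j (x ⊗ₜ y) = φ (j x) * j y := by
  simp [rightMul]

theorem leftMul_mul_e (h : IsTripleEnvelope φ j T e) (s : M ⊗[R] M) :
    leftMul φ j s * e = leftMul φ j s := by
  induction s using TensorProduct.induction_on with
  | zero => simp
  | tmul x y => rw [leftMul_tmul, mul_assoc, h.star_mul_e]
  | add a b ha hb => rw [map_add, add_mul, ha, hb]

theorem e_mul_leftMul (h : IsTripleEnvelope φ j T e) (s : M ⊗[R] M) :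
    e * leftMul φ j s = leftMul φ j s := by
  induction s using TensorProduct.induction_on with
  | zero => simp
  | tmul x y => rw [leftMul_tmul, ← mul_assoc, h.e_mul]
  | add a b ha hb => rw [map_add, mul_add, ha, hb]

theorem rightMul_mul_e (h : IsTripleEnvelope φ j T e) (s : M ⊗[R] M) :
    rightMul φ j s * e = 0 := by
  induction s using TensorProduct.induction_on with
  | zero => simp
  | tmul x y => rw [rightMul_tmul, mul_assoc, h.mul_e, MulZeroClass.mul_zero]
  | add a b ha hb => rw [map_add, add_mul, ha, hb, add_zero]

theorem e_mul_rightMul (h : IsTripleEnvelope φ j T e) (s : M ⊗[R] M) :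
    e * rightMul φ j s = 0 := by
  induction s using TensorProduct.induction_on with
  | zero => simp
  | tmul x y => rw [rightMul_tmul, ← mul_assoc, h.e_mul_star, zero_mul]
  | add a b ha hb => rw [map_add, mul_add, ha, hb, add_zero]

theorem leftMul_eq_zero (h : IsTripleEnvelope φ j T e) {s : M ⊗[R] M}
    (hs : ∀ z, leftMul φ j s * j z = 0) : leftMul φ j s = 0 := by
  rw [← h.leftMul_mul_e]
  have := h.e_mem
  generalize e = b at this ⊢
  induction this using Submodule.span_induction with
  | mem b hb => obtain ⟨x, y, rfl⟩ := hb; rw [← mul_assoc, hs, zero_mul]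
  | zero => simp
  | add a b _ _ ha hb => rw [mul_add, ha, hb, add_zero]
  | smul c a _ ha => rw [mul_smul_comm, ha, smul_zero]

theorem rightMul_eq_zero (h : IsTripleEnvelope φ j T e) {s : M ⊗[R] M}
    (hs : ∀ z, j z * rightMul φ j s = 0) : rightMul φ j s = 0 := by
  have key : (1 - e) * rightMul φ j s = rightMul φ j s := by
    rw [sub_mul, h.e_mul_rightMul, one_mul, sub_zero]
  rw [← key]
  have := h.compl_mem
  generalize 1 - e = b at this ⊢
  induction this using Submodule.span_induction with
  | mem b hb => obtain ⟨x, y, rfl⟩ := hb; rw [mul_assoc, hs, MulZeroClass.mul_zero]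
  | zero => simp
  | add a b _ _ ha hb => rw [add_mul, ha, hb, add_zero]
  | smul c a _ ha => rw [smul_mul_assoc, ha, smul_zero]

theorem leftMul_map_eq_zero (h : IsTripleEnvelope φ j T e) (ψ : M ≃ₗ[R] M)
    (hψ : ∀ x y z, ψ (T x y z) = T (ψ x) (ψ y) (ψ z)) {s : M ⊗[R] M} (hs : leftMul φ j s = 0) :
    leftMul φ j (TensorProduct.map ψ.toLinearMap ψ.toLinearMap s) = 0 := by
  refine h.leftMul_eq_zero fun z' => ?_
  obtain ⟨z, rfl⟩ := ψ.surjective z'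
  have key : ∃ w, leftMul φ j s * j z = j w ∧
      leftMul φ j (TensorProduct.map ψ.toLinearMap ψ.toLinearMap s) * j (ψ z) = j (ψ w) := by
    clear hs
    induction s using TensorProduct.induction_on with
    | zero => exact ⟨0, by simp⟩
    | tmul x y => exact ⟨T x y z, by simp [h.triple, hψ]⟩
    | add a b ha hb =>
      obtain ⟨v, hv, hv'⟩ := ha
      obtain ⟨w, hw, hw'⟩ := hb
      exact ⟨v + w, by simp [add_mul, hv, hw], by simp [add_mul, hv', hw']⟩
  obtain ⟨w, hw, hw'⟩ := key
  rw [hs, zero_mul, ← map_zero j] at hw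
  rw [hw', ← h.inj hw, map_zero, map_zero]

theorem rightMul_map_eq_zero (h : IsTripleEnvelope φ j T e) (ψ : M ≃ₗ[R] M)
    (hψ : ∀ x y z, ψ (T x y z) = T (ψ x) (ψ y) (ψ z)) {s : M ⊗[R] M} (hs : rightMul φ j s = 0) :
    rightMul φ j (TensorProduct.map ψ.toLinearMap ψ.toLinearMap s) = 0 := by
  refine h.rightMul_eq_zero fun z' => ?_
  obtain ⟨z, rfl⟩ := ψ.surjective z'
  have key : ∃ w, j z * rightMul φ j s = j w ∧
      j (ψ z) * rightMul φ j (TensorProduct.map ψ.toLinearMap ψ.toLinearMap s) = j (ψ w) := by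
    clear hs
    induction s using TensorProduct.induction_on with
    | zero => exact ⟨0, by simp⟩
    | tmul x y => exact ⟨T z x y, by simp [h.triple, hψ, mul_assoc]⟩
    | add a b ha hb =>
      obtain ⟨v, hv, hv'⟩ := ha
      obtain ⟨w, hw, hw'⟩ := hb
      exact ⟨v + w, by simp [mul_add, hv, hw], by simp [mul_add, hv', hw']⟩
  obtain ⟨w, hw, hw'⟩ := key
  rw [hs, MulZeroClass.mul_zero, ← map_zero j] at hw
  rw [hw', ← h.inj hw, map_zero, map_zero]

/-- The presentation of the envelope by the four Peirce pieces. -/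
def presentation (φ : B →ₗ[R] B) (j : M →ₗ[R] B) :
    (M × M) × (M ⊗[R] M) × (M ⊗[R] M) →ₗ[R] B :=
  (j.coprod (φ ∘ₗ j)).coprod ((leftMul φ j).coprod (rightMul φ j))

theorem presentation_surjective (h : IsTripleEnvelope φ j T e) :
    Function.Surjective (presentation φ j) := by
  intro b
  change b ∈ LinearMap.range (presentation φ j)
  induction b using h.induction with
  | hj x => exact ⟨((x, 0), 0, 0), by simp [presentation]⟩
  | hs x => exact ⟨((0, x), 0, 0), by simp [presentation]⟩
  | hl x y => exact ⟨((0, 0), x ⊗ₜ y, 0), by simp [presentation]⟩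
  | hr x y => exact ⟨((0, 0), 0, x ⊗ₜ y), by simp [presentation]⟩
  | hadd a b ha hb => exact add_mem ha hb
  | hsmul c a ha => exact Submodule.smul_mem _ c ha

/-- The map induced by `ψ` on the four Peirce pieces. -/
def presentationMap (ψ : M ≃ₗ[R] M) :
    (M × M) × (M ⊗[R] M) × (M ⊗[R] M) →ₗ[R] (M × M) × (M ⊗[R] M) × (M ⊗[R] M) :=
  (ψ.toLinearMap.prodMap ψ.toLinearMap).prodMap
    ((TensorProduct.map ψ.toLinearMap ψ.toLinearMap).prodMap
      (TensorProduct.map ψ.toLinearMap ψ.toLinearMap))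

theorem ker_presentation_le (h : IsTripleEnvelope φ j T e) (ψ : M ≃ₗ[R] M)
    (hψ : ∀ x y z, ψ (T x y z) = T (ψ x) (ψ y) (ψ z)) :
    LinearMap.ker (presentation φ j) ≤ LinearMap.ker (presentation φ j ∘ₗ presentationMap ψ) := by
  rintro ⟨⟨x, y⟩, s, t⟩ h0
  have h0 : j x + φ (j y) + (leftMul φ j s + rightMul φ j t) = 0 := by
    simpa [presentation] using h0
  have left : j x + leftMul φ j s = 0 := by
    have := congrArg (e * ·) h0
    simpa [mul_add, h.e_mul, h.e_mul_star, h.e_mul_leftMul, h.e_mul_rightMul] using this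
  have hs : leftMul φ j s = 0 := by
    have := congrArg (· * e) left
    simpa [add_mul, h.mul_e, h.leftMul_mul_e] using this
  have hx : j x = 0 := by simpa [hs] using left
  have right : φ (j y) + rightMul φ j t = 0 := by simpa [hs, hx] using h0
  have hy : φ (j y) = 0 := by
    have := congrArg (· * e) right
    simpa [add_mul, h.star_mul_e, h.rightMul_mul_e] using this
  have ht : rightMul φ j t = 0 := by simpa [hy] using right
  have hx' : x = 0 := h.inj (by rw [hx, map_zero])
  have hy' : y = 0 := h.inj (by rw [← h.invol (j y), hy, map_zero, map_zero])
  simp [presentation, presentationMap, hx', hy', h.leftMul_map_eq_zero ψ hψ hs,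
    h.rightMul_map_eq_zero ψ hψ ht]

theorem exists_linearMap (h : IsTripleEnvelope φ j T e) (ψ : M ≃ₗ[R] M)
    (hψ : ∀ x y z, ψ (T x y z) = T (ψ x) (ψ y) (ψ z)) :
    ∃ f : B →ₗ[R] B, (∀ x, f (j x) = j (ψ x)) ∧ (∀ x, f (φ (j x)) = φ (j (ψ x))) ∧
      (∀ x y, f (j x * φ (j y)) = j (ψ x) * φ (j (ψ y))) ∧
      ∀ x y, f (φ (j x) * j y) = φ (j (ψ x)) * j (ψ y) := by
  let f : B →ₗ[R] B := (LinearMap.ker (presentation φ j)).liftQ _ (h.ker_presentation_le ψ hψ) ∘ₗ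
    ((presentation φ j).quotKerEquivOfSurjective h.presentation_surjective).symm.toLinearMap
  have hf : ∀ n, f (presentation φ j n) = presentation φ j (presentationMap ψ n) := fun n => by
    have : ((presentation φ j).quotKerEquivOfSurjective h.presentation_surjective).symm
        (presentation φ j n) = Submodule.Quotient.mk n := by
      rw [LinearEquiv.symm_apply_eq]; rfl
    change (LinearMap.ker (presentation φ j)).liftQ _ (h.ker_presentation_le ψ hψ)
      (LinearEquiv.symm _ _) = _
    rw [this]; rfl
  refine ⟨f, fun x => ?_, fun x => ?_, fun x y => ?_, fun x y => ?_⟩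
  · simpa [presentation, presentationMap] using hf ((x, 0), 0, 0)
  · simpa [presentation, presentationMap] using hf ((0, x), 0, 0)
  · simpa [presentation, presentationMap] using hf ((0, 0), x ⊗ₜ y, 0)
  · simpa [presentation, presentationMap] using hf ((0, 0), 0, x ⊗ₜ y)

theorem exists_algHom (h : IsTripleEnvelope φ j T e) (ψ : M ≃ₗ[R] M)
    (hψ : ∀ x y z, ψ (T x y z) = T (ψ x) (ψ y) (ψ z)) :
    ∃ f : B →ₐ[R] B, (∀ x, f (j x) = j (ψ x)) ∧ ∀ b, f (φ b) = φ (f b) := by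
  obtain ⟨f, hj, hs, hl, hr⟩ := h.exists_linearMap ψ hψ
  have mul_j : ∀ x b, f (j x * b) = f (j x) * f b := fun x b => by
    induction b using h.induction with
    | hj y => rw [hj, hj, h.mul_zero, h.mul_zero, map_zero]
    | hs y => rw [hl, hj, hs]
    | hl y z => rw [← mul_assoc, h.mul_zero, hl, hj, ← mul_assoc, h.mul_zero]; simp
    | hr y z => rw [← mul_assoc, ← h.triple, hr, hj, hj, hψ, h.triple, mul_assoc]
    | hadd a b ha hb => rw [mul_add, map_add, ha, hb, map_add, mul_add]
    | hsmul c a ha => rw [mul_smul_comm, map_smul, ha, map_smul, mul_smul_comm]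
  have mul_s : ∀ x b, f (φ (j x) * b) = f (φ (j x)) * f b := fun x b => by
    induction b using h.induction with
    | hj y => rw [hr, hj, hs]
    | hs y => rw [hs, hs, h.star_mul_star, h.star_mul_star, map_zero]
    | hl y z =>
      rw [← mul_assoc, ← h.star_triple, hl, hs, hs, hψ, h.star_triple, mul_assoc]
    | hr y z => rw [← mul_assoc, h.star_mul_star, hr, hs, ← mul_assoc, h.star_mul_star]; simp
    | hadd a b ha hb => rw [mul_add, map_add, ha, hb, map_add, mul_add]
    | hsmul c a ha => rw [mul_smul_comm, map_smul, ha, map_smul, mul_smul_comm]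
  have mul : ∀ a b, f (a * b) = f a * f b := fun a b => by
    induction a using h.induction with
    | hj x => exact mul_j x b
    | hs x => exact mul_s x b
    | hl x y => rw [mul_assoc, mul_j, mul_s, mul_j, mul_assoc]
    | hr x y => rw [mul_assoc, mul_s, mul_j, mul_s, mul_assoc]
    | hadd c d hc hd => rw [add_mul, map_add, hc, hd, map_add, add_mul]
    | hsmul c d hd => rw [smul_mul_assoc, map_smul, hd, map_smul, smul_mul_assoc]
  have surj : Function.Surjective f := fun b => by
    change b ∈ LinearMap.range f
    induction b using h.induction with
    | hj x => exact ⟨j (ψ.symm x), by rw [hj, ψ.apply_symm_apply]⟩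
    | hs x => exact ⟨φ (j (ψ.symm x)), by rw [hs, ψ.apply_symm_apply]⟩
    | hl x y => exact ⟨j (ψ.symm x) * φ (j (ψ.symm y)), by simp [hl]⟩
    | hr x y => exact ⟨φ (j (ψ.symm x)) * j (ψ.symm y), by simp [hr]⟩
    | hadd a b ha hb => exact add_mem ha hb
    | hsmul c a ha => exact Submodule.smul_mem _ c ha
  have one : f 1 = 1 := by
    obtain ⟨a, ha⟩ := surj 1
    calc f 1 = f 1 * f a := by rw [ha, mul_one]
      _ = 1 := by rw [← mul, one_mul, ha]
  refine ⟨AlgHom.ofLinearMap f one mul, hj, fun b => ?_⟩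
  change f (φ b) = φ (f b)
  induction b using h.induction with
  | hj x => rw [hs, hj]
  | hs x => rw [hs, h.invol, h.invol, hj]
  | hl x y => rw [hl, h.anti, h.anti, h.invol, h.invol, hl]
  | hr x y => rw [hr, h.anti, h.anti, h.invol, h.invol, hr]
  | hadd a b ha hb => rw [map_add, map_add, ha, hb, map_add, map_add]
  | hsmul c a ha => rw [map_smul, map_smul, ha, map_smul, map_smul]

theorem exists_algEquiv (h : IsTripleEnvelope φ j T e) (ψ : M ≃ₗ[R] M)
    (hψ : ∀ x y z, ψ (T x y z) = T (ψ x) (ψ y) (ψ z)) :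
    ∃ f : B ≃ₐ[R] B, (∀ x, f (j x) = j (ψ x)) ∧ ∀ b, f (φ b) = φ (f b) := by
  have hψ' : ∀ x y z, ψ.symm (T x y z) = T (ψ.symm x) (ψ.symm y) (ψ.symm z) := fun x y z => by
    rw [LinearEquiv.symm_apply_eq, hψ]; simp
  obtain ⟨f, hf, hf'⟩ := h.exists_algHom ψ hψ
  obtain ⟨g, hg, hg'⟩ := h.exists_algHom ψ.symm hψ'
  exact ⟨AlgEquiv.ofAlgHom f g
    (h.algHom_ext (fun b => by simp [hf', hg']) (fun _ => rfl) (fun x => by simp [hf, hg]))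
    (h.algHom_ext (fun b => by simp [hf', hg']) (fun _ => rfl) (fun x => by simp [hf, hg])),
    hf, hf'⟩

end General

section BaseChange

variable {F A W R : Type*} [Field F] [Ring A] [Algebra F A] [AddCommGroup W] [Module F W]
  [CommRing R] [Algebra F R] {φ : A →ₗ[F] A} {ι : W →ₗ[F] A} {p : W →ₗ[F] W →ₗ[F] W →ₗ[F] W}
  {e : A}

theorem tmul_mem_span {S : Set A} {S' : Set (R ⊗[F] A)} (hS : ∀ a ∈ S, (1 : R) ⊗ₜ[F] a ∈ S')
    {a : A} (ha : a ∈ Submodule.span F S) : (1 : R) ⊗ₜ[F] a ∈ Submodule.span R S' := by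
  induction ha using Submodule.span_induction with
  | mem a ha => exact Submodule.subset_span (hS a ha)
  | zero => simp
  | add a b _ _ ha hb => rw [TensorProduct.tmul_add]; exact add_mem ha hb
  | smul c a _ ha => rw [TensorProduct.tmul_smul]; exact Submodule.smul_of_tower_mem _ c ha

theorem forall_baseChange {V : Type*} [AddCommGroup V] [Module F V] {U : Type*} [AddCommGroup U]
    [Module R U] {f g : R ⊗[F] V →ₗ[R] U} (hfg : ∀ v, f (1 ⊗ₜ v) = g (1 ⊗ₜ v)) (x : R ⊗[F] V) :
    f x = g x := by
  induction x using TensorProduct.induction_on with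
  | zero => rw [map_zero, map_zero]
  | add x y hx hy => rw [map_add, map_add, hx, hy]
  | tmul r v =>
    have : r ⊗ₜ[F] v = r • ((1 : R) ⊗ₜ[F] v) := by simp [TensorProduct.smul_tmul']
    rw [this, map_smul, map_smul, hfg]

theorem baseChange_anti (hφ : ∀ a b, φ (a * b) = φ b * φ a) (a b : R ⊗[F] A) :
    φ.baseChange R (a * b) = φ.baseChange R b * φ.baseChange R a := by
  induction a using TensorProduct.induction_on with
  | zero => simp
  | add a a' ha ha' => rw [add_mul, map_add, ha, ha', map_add, mul_add]
  | tmul r a =>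
    induction b using TensorProduct.induction_on with
    | zero => simp
    | add b b' hb hb' => rw [mul_add, map_add, hb, hb', map_add, add_mul]
    | tmul s b => simp [hφ, mul_comm]

theorem baseChange_triple (hp : ∀ x y z, ι (p x y z) = ι x * φ (ι y) * ι z)
    (pR : (R ⊗[F] W) →ₗ[R] (R ⊗[F] W) →ₗ[R] (R ⊗[F] W) →ₗ[R] (R ⊗[F] W))
    (hpR : ∀ x y z : W, pR ((1 : R) ⊗ₜ[F] x) ((1 : R) ⊗ₜ[F] y) ((1 : R) ⊗ₜ[F] z) =
      (1 : R) ⊗ₜ[F] p x y z) (x y z : R ⊗[F] W) :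
    ι.baseChange R (pR x y z) =
      ι.baseChange R x * φ.baseChange R (ι.baseChange R y) * ι.baseChange R z := by
  have hsmul : ∀ (r : R) (w : W), r ⊗ₜ[F] w = r • ((1 : R) ⊗ₜ[F] w) := fun r w => by
    simp [TensorProduct.smul_tmul']
  induction x using TensorProduct.induction_on with
  | zero => simp
  | add x x' hx hx' => simp only [map_add, LinearMap.add_apply, hx, hx', add_mul]
  | tmul a x =>
    induction y using TensorProduct.induction_on with
    | zero => simp
    | add y y' hy hy' => simp only [map_add, LinearMap.add_apply, hy, hy', mul_add, add_mul]
    | tmul b y =>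
      induction z using TensorProduct.induction_on with
      | zero => simp
      | add z z' hz hz' => simp only [map_add, hz, hz', mul_add]
      | tmul c z =>
        rw [hsmul a, hsmul b, hsmul c]
        simp only [map_smul, LinearMap.smul_apply, hpR, LinearMap.baseChange_tmul, hp,
          smul_mul_assoc, mul_smul_comm, Algebra.TensorProduct.tmul_mul_tmul, one_mul]

theorem baseChange (h : IsTripleEnvelope φ ι p e)
    (pR : (R ⊗[F] W) →ₗ[R] (R ⊗[F] W) →ₗ[R] (R ⊗[F] W) →ₗ[R] (R ⊗[F] W))
    (hpR : ∀ x y z : W, pR ((1 : R) ⊗ₜ[F] x) ((1 : R) ⊗ₜ[F] y) ((1 : R) ⊗ₜ[F] z) =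
      (1 : R) ⊗ₜ[F] p x y z) :
    IsTripleEnvelope (φ.baseChange R) (ι.baseChange R) pR ((1 : R) ⊗ₜ[F] e) where
  invol := forall_baseChange (f := φ.baseChange R ∘ₗ φ.baseChange R) (g := LinearMap.id)
    fun a => by simp [h.invol]
  anti := baseChange_anti h.anti
  inj := Module.Flat.lTensor_preserves_injective_linearMap ι h.inj
  triple := baseChange_triple h.triple pR hpR
  mul_zero x y := by
    induction x using TensorProduct.induction_on with
    | zero => simp
    | add x x' hx hx' => rw [map_add, add_mul, hx, hx', add_zero]
    | tmul a x =>
      exact forall_baseChange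
        (f := LinearMap.mulLeft R (ι.baseChange R (a ⊗ₜ x)) ∘ₗ ι.baseChange R) (g := 0)
        (fun y => by simp [h.mul_zero]) y
  e_mul := forall_baseChange (f := LinearMap.mulLeft R ((1 : R) ⊗ₜ[F] e) ∘ₗ ι.baseChange R)
    fun x => by simp [h.e_mul]
  mul_e := forall_baseChange (f := LinearMap.mulRight R ((1 : R) ⊗ₜ[F] e) ∘ₗ ι.baseChange R)
    (g := 0) fun x => by simp [h.mul_e]
  e_mul_star := forall_baseChange
    (f := LinearMap.mulLeft R ((1 : R) ⊗ₜ[F] e) ∘ₗ φ.baseChange R ∘ₗ ι.baseChange R) (g := 0)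
    fun x => by simp [h.e_mul_star]
  star_mul_e := forall_baseChange
    (f := LinearMap.mulRight R ((1 : R) ⊗ₜ[F] e) ∘ₗ φ.baseChange R ∘ₗ ι.baseChange R)
    (g := φ.baseChange R ∘ₗ ι.baseChange R) fun x => by simp [h.star_mul_e]
  e_mem := tmul_mem_span (S := leftProducts φ ι)
    (by rintro _ ⟨x, y, rfl⟩; exact ⟨1 ⊗ₜ x, 1 ⊗ₜ y, by simp⟩) h.e_mem
  compl_mem := by
    rw [Algebra.TensorProduct.one_def, ← TensorProduct.tmul_sub]
    exact tmul_mem_span (S := rightProducts φ ι)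
      (by rintro _ ⟨x, y, rfl⟩; exact ⟨1 ⊗ₜ x, 1 ⊗ₜ y, by simp⟩) h.compl_mem
  span_top := by
    refine eq_top_iff.2 fun x _ => ?_
    induction x using TensorProduct.induction_on with
    | zero => exact zero_mem _
    | add x y hx hy => exact add_mem (hx trivial) (hy trivial)
    | tmul r a =>
      have : r ⊗ₜ[F] a = r • ((1 : R) ⊗ₜ[F] a) := by simp [TensorProduct.smul_tmul']
      rw [this]
      refine Submodule.smul_mem _ _ (tmul_mem_span ?_ (h.span_top ▸ Submodule.mem_top :
        a ∈ Submodule.span F _))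
      rintro _ (((⟨x, rfl⟩ | ⟨x, rfl⟩) | ⟨x, y, rfl⟩) | ⟨x, y, rfl⟩)
      · exact .inl (.inl (.inl ⟨1 ⊗ₜ x, by simp⟩))
      · exact .inl (.inl (.inr ⟨1 ⊗ₜ x, by simp⟩))
      · exact .inl (.inr ⟨1 ⊗ₜ x, 1 ⊗ₜ y, by simp⟩)
      · exact .inr ⟨1 ⊗ₜ x, 1 ⊗ₜ y, by simp⟩

end BaseChange

section Graded

variable {F A W : Type*} [Field F] [Ring A] [Algebra F A] [AddCommGroup W] [Module F W]
  {φ : A →ₗ[F] A} {ι : W →ₗ[F] A} {p : W →ₗ[F] W →ₗ[F] W →ₗ[F] W} {e : A}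
  {𝒜 : ℤ → Submodule F A}

theorem star_mem_one (hφgr : ∀ i : ℤ, Submodule.map φ (𝒜 i) = 𝒜 (-i))
    (hιrange : LinearMap.range ι = 𝒜 (-1)) (x : W) : φ (ι x) ∈ 𝒜 1 := by
  have := hφgr (-1)
  rw [neg_neg] at this
  rw [← this]
  exact ⟨ι x, hιrange ▸ ⟨x, rfl⟩, rfl⟩

theorem span_eq_top (hφ₂ : ∀ a, φ (φ a) = a) (hφmul : ∀ a b, φ (a * b) = φ b * φ a)
    (hsimple : ∀ I : Submodule F A,
      (∀ a : A, ∀ x ∈ I, a * x ∈ I ∧ x * a ∈ I) → (∀ x ∈ I, φ x ∈ I) → I = ⊥ ∨ I = ⊤)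
    (hinternal : DirectSum.IsInternal 𝒜)
    (hsupp : ∀ i : ℤ, i ≠ -1 → i ≠ 0 → i ≠ 1 → 𝒜 i = ⊥)
    (hmul : ∀ i j : ℤ, ∀ x ∈ 𝒜 i, ∀ y ∈ 𝒜 j, x * y ∈ 𝒜 (i + j))
    (hφgr : ∀ i : ℤ, Submodule.map φ (𝒜 i) = 𝒜 (-i))
    (hιrange : LinearMap.range ι = 𝒜 (-1)) (hι : ι ≠ 0) :
    Submodule.span F (Set.range ι ∪ Set.range (fun x => φ (ι x)) ∪
      leftProducts φ ι ∪ rightProducts φ ι) = ⊤ := by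
  set I := Submodule.span F (Set.range ι ∪ Set.range (fun x => φ (ι x)) ∪
      leftProducts φ ι ∪ rightProducts φ ι) with hI
  have memj : ∀ x, ι x ∈ I := fun x => Submodule.subset_span (.inl (.inl (.inl ⟨x, rfl⟩)))
  have mems : ∀ x, φ (ι x) ∈ I := fun x => Submodule.subset_span (.inl (.inl (.inr ⟨x, rfl⟩)))
  have meml : ∀ x y, ι x * φ (ι y) ∈ I := fun x y =>
    Submodule.subset_span (.inl (.inr ⟨x, y, rfl⟩))
  have memr : ∀ x y, φ (ι x) * ι y ∈ I := fun x y => Submodule.subset_span (.inr ⟨x, y, rfl⟩)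
  have degj : ∀ x, ι x ∈ 𝒜 (-1) := fun x => hιrange ▸ ⟨x, rfl⟩
  have exj : ∀ a ∈ 𝒜 (-1), ∃ x, ι x = a := fun a ha => by rwa [← hιrange] at ha
  have exs : ∀ a ∈ 𝒜 1, ∃ x, φ (ι x) = a := fun a ha => by
    have := hφgr (-1)
    rw [neg_neg] at this
    rw [← this] at ha
    obtain ⟨b, hb, rfl⟩ := ha
    obtain ⟨x, rfl⟩ := exj b hb
    exact ⟨x, rfl⟩
  have degs := star_mem_one hφgr hιrange
  have zero2 : ∀ a ∈ 𝒜 (-1 + -1), a ∈ I := fun a ha => by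
    rw [hsupp _ (by decide) (by decide) (by decide), Submodule.mem_bot] at ha
    exact ha ▸ zero_mem _
  have zero2' : ∀ a ∈ 𝒜 (1 + 1), a ∈ I := fun a ha => by
    rw [hsupp _ (by decide) (by decide) (by decide), Submodule.mem_bot] at ha
    exact ha ▸ zero_mem _
  have gen : ∀ a : A, (∀ x, a * ι x ∈ I) ∧ ∀ x, a * φ (ι x) ∈ I := fun a => by
    have ha : a ∈ ⨆ i, 𝒜 i := hinternal.submodule_iSup_eq_top ▸ Submodule.mem_top
    induction ha using Submodule.iSup_induction' with
    | mem i a ha =>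
      by_cases h1 : i = -1
      · subst h1
        refine ⟨fun x => zero2 _ (hmul _ _ _ ha _ (degj x)), fun x => ?_⟩
        obtain ⟨y, rfl⟩ := exj a ha
        exact meml y x
      by_cases h2 : i = 0
      · subst h2
        refine ⟨fun x => ?_, fun x => ?_⟩
        · obtain ⟨y, hy⟩ := exj _ (by simpa using hmul _ _ _ ha _ (degj x))
          exact hy ▸ memj y
        · obtain ⟨y, hy⟩ := exs _ (by simpa using hmul _ _ _ ha _ (degs x))
          exact hy ▸ mems y
      by_cases h3 : i = 1
      · subst h3
        refine ⟨fun x => ?_, fun x => zero2' _ (hmul _ _ _ ha _ (degs x))⟩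
        obtain ⟨y, rfl⟩ := exs a ha
        exact memr y x
      rw [hsupp i h1 h2 h3, Submodule.mem_bot] at ha
      simp [ha]
    | zero => simp
    | add a b _ _ ha hb =>
      exact ⟨fun x => add_mul a b (ι x) ▸ add_mem (ha.1 x) (hb.1 x),
        fun x => add_mul a b (φ (ι x)) ▸ add_mem (ha.2 x) (hb.2 x)⟩
  have left : ∀ a : A, ∀ x ∈ I, a * x ∈ I := fun a x hx => by
    induction hx using Submodule.span_induction with
    | mem x hx =>
      rcases hx with ((⟨x, rfl⟩ | ⟨x, rfl⟩) | ⟨x, y, rfl⟩) | ⟨x, y, rfl⟩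
      · exact (gen a).1 x
      · exact (gen a).2 x
      · rw [← mul_assoc]; exact (gen _).2 y
      · rw [← mul_assoc]; exact (gen _).1 y
    | zero => simp
    | add x y _ _ hx hy => rw [mul_add]; exact add_mem hx hy
    | smul c x _ hx => rw [mul_smul_comm]; exact Submodule.smul_mem _ c hx
  have stable : ∀ x ∈ I, φ x ∈ I := fun x hx => by
    induction hx using Submodule.span_induction with
    | mem x hx =>
      rcases hx with ((⟨x, rfl⟩ | ⟨x, rfl⟩) | ⟨x, y, rfl⟩) | ⟨x, y, rfl⟩
      · exact mems x
      · simpa only [hφ₂] using memj x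
      · rw [hφmul, hφ₂]; exact meml y x
      · rw [hφmul, hφ₂]; exact memr y x
    | zero => simp
    | add x y _ _ hx hy => rw [map_add]; exact add_mem hx hy
    | smul c x _ hx => rw [map_smul]; exact Submodule.smul_mem _ c hx
  refine (hsimple I (fun a x hx => ⟨left a x hx, ?_⟩) stable).resolve_left fun hbot => hι ?_
  · rw [← hφ₂ (x * a), hφmul]
    exact stable _ (left _ _ (stable x hx))
  · ext x
    have := memj x
    rw [hbot, Submodule.mem_bot] at this
    simp [this]

theorem exists_of_graded (hφ₂ : ∀ a, φ (φ a) = a) (hφmul : ∀ a b, φ (a * b) = φ b * φ a)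
    (hsimple : ∀ I : Submodule F A,
      (∀ a : A, ∀ x ∈ I, a * x ∈ I ∧ x * a ∈ I) → (∀ x ∈ I, φ x ∈ I) → I = ⊥ ∨ I = ⊤)
    (hinternal : DirectSum.IsInternal 𝒜)
    (hsupp : ∀ i : ℤ, i ≠ -1 → i ≠ 0 → i ≠ 1 → 𝒜 i = ⊥)
    (hmul : ∀ i j : ℤ, ∀ x ∈ 𝒜 i, ∀ y ∈ 𝒜 j, x * y ∈ 𝒜 (i + j))
    (hφgr : ∀ i : ℤ, Submodule.map φ (𝒜 i) = 𝒜 (-i))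
    (hιinj : Function.Injective ι) (hιrange : LinearMap.range ι = 𝒜 (-1)) (hι : ι ≠ 0)
    (hιtriple : ∀ x y z : W, ι (p x y z) = ι x * φ (ι y) * ι z) :
    ∃ e, IsTripleEnvelope φ ι p e := by
  have top := span_eq_top hφ₂ hφmul hsimple hinternal hsupp hmul hφgr hιrange hι
  have degj : ∀ x, ι x ∈ 𝒜 (-1) := fun x => hιrange ▸ ⟨x, rfl⟩
  have degs := star_mem_one hφgr hιrange
  have jj : ∀ x y, ι x * ι y = 0 := fun x y => by
    have := hmul _ _ _ (degj x) _ (degj y)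
    rwa [hsupp _ (by decide) (by decide) (by decide), Submodule.mem_bot] at this
  have ss : ∀ x y, φ (ι x) * φ (ι y) = 0 := fun x y => by rw [← hφmul, jj, map_zero]
  have disj : ∀ i k : ℤ, i ≠ k → ∀ a b, a ∈ 𝒜 i → b ∈ 𝒜 k → a = b → a = 0 :=
    fun i k hik a b ha hb hab => by
      have := (hinternal.submodule_iSupIndep.pairwiseDisjoint hik).le_bot
        (show a ∈ 𝒜 i ⊓ 𝒜 k from ⟨ha, hab ▸ hb⟩)
      simpa using this
  have one_mem : (1 : A) ∈ Submodule.span F (Set.range ι ∪ Set.range (fun x => φ (ι x)) ∪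
      leftProducts φ ι ∪ rightProducts φ ι) := top ▸ Submodule.mem_top
  have hr1 : Set.range ι = (LinearMap.range ι : Set A) := rfl
  have hr2 : Set.range (fun x => φ (ι x)) = (LinearMap.range (φ ∘ₗ ι) : Set A) := rfl
  rw [Submodule.span_union, Submodule.span_union, Submodule.span_union, hr1, hr2,
    Submodule.span_eq, Submodule.span_eq, Submodule.mem_sup] at one_mem
  obtain ⟨_, h1, r, hr, one_eq⟩ := one_mem
  obtain ⟨_, h2, l, hl, rfl⟩ := Submodule.mem_sup.1 h1
  obtain ⟨_, ⟨a, rfl⟩, _, ⟨b, rfl⟩, rfl⟩ := Submodule.mem_sup.1 h2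
  have hl0 : l ∈ 𝒜 0 := by
    refine Submodule.span_le.2 ?_ hl
    rintro _ ⟨x, y, rfl⟩
    simpa using hmul _ _ _ (degj x) _ (degs y)
  have hr0 : r ∈ 𝒜 0 := by
    refine Submodule.span_le.2 ?_ hr
    rintro _ ⟨x, y, rfl⟩
    simpa using hmul _ _ _ (degs x) _ (degj y)
  have ker_of_span : ∀ (g : A →ₗ[F] A) (S : Set A), (∀ b ∈ S, g b = 0) →
      ∀ b ∈ Submodule.span F S, g b = 0 := fun g S hS b hb =>
    (Submodule.span_le (p := LinearMap.ker g)).2 hS hb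
  have jl : ∀ x, ι x * l = 0 := fun x => ker_of_span (LinearMap.mulLeft F (ι x)) _
    (by rintro _ ⟨y, z, rfl⟩; simp [← mul_assoc, jj]) l hl
  have ls : ∀ x, l * φ (ι x) = 0 := fun x => ker_of_span (LinearMap.mulRight F (φ (ι x))) _
    (by rintro _ ⟨y, z, rfl⟩; simp [mul_assoc, ss]) l hl
  have sr : ∀ x, φ (ι x) * r = 0 := fun x => ker_of_span (LinearMap.mulLeft F (φ (ι x))) _
    (by rintro _ ⟨y, z, rfl⟩; simp [← mul_assoc, ss]) r hr
  have rj : ∀ x, r * ι x = 0 := fun x => ker_of_span (LinearMap.mulRight F (ι x)) _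
    (by rintro _ ⟨y, z, rfl⟩; simp [mul_assoc, jj]) r hr
  have lj : ∀ x, l * ι x = ι x := fun x => by
    have h0 : φ (ι b) * ι x = ι x - l * ι x := by
      have := congrArg (· * ι x) one_eq
      simp only [LinearMap.comp_apply, add_mul, jj, rj, zero_add, add_zero, one_mul] at this
      rw [eq_sub_iff_add_eq, this]
    have h1 := disj 0 (-1) (by decide) _ _ (by simpa using hmul _ _ _ (degs b) _ (degj x))
      (sub_mem (degj x) (by simpa using hmul _ _ _ hl0 _ (degj x))) h0
    exact (sub_eq_zero.1 (h0.symm.trans h1)).symm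
  have rs : ∀ x, r * φ (ι x) = φ (ι x) := fun x => by
    have h0 : ι a * φ (ι x) = φ (ι x) - r * φ (ι x) := by
      have := congrArg (· * φ (ι x)) one_eq
      simp only [LinearMap.comp_apply, add_mul, ss, ls, add_zero, one_mul] at this
      rw [eq_sub_iff_add_eq, this]
    have h1 := disj 0 1 (by decide) _ _ (by simpa using hmul _ _ _ (degj a) _ (degs x))
      (sub_mem (degs x) (by simpa using hmul _ _ _ hr0 _ (degs x))) h0
    exact (sub_eq_zero.1 (h0.symm.trans h1)).symm
  have sl : ∀ x, φ (ι x) * l = φ (ι x) := fun x => by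
    have h0 : φ (ι x) * ι a = φ (ι x) - φ (ι x) * l := by
      have := congrArg (φ (ι x) * ·) one_eq
      simp only [LinearMap.comp_apply, mul_add, ss, sr, add_zero, mul_one] at this
      rw [eq_sub_iff_add_eq, this]
    have h1 := disj 0 1 (by decide) _ _ (by simpa using hmul _ _ _ (degs x) _ (degj a))
      (sub_mem (degs x) (by simpa using hmul _ _ _ (degs x) _ hl0)) h0
    exact (sub_eq_zero.1 (h0.symm.trans h1)).symm
  have one_eq' : 1 = l + r := by
    have := ker_of_span (LinearMap.mulLeft F (l + r) - LinearMap.id) _ (by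
      rintro _ (((⟨x, rfl⟩ | ⟨x, rfl⟩) | ⟨x, y, rfl⟩) | ⟨x, y, rfl⟩) <;>
        simp [add_mul, ← mul_assoc, lj, rj, ls, rs]) 1 (top ▸ Submodule.mem_top)
    exact (sub_eq_zero.1 (by simpa using this)).symm
  exact ⟨l, hφ₂, hφmul, hιinj, hιtriple, jj, lj, jl, ls, sl, hl, by
    rwa [one_eq', add_sub_cancel_left], top⟩

/-- The degree-zero component is the sum of the two spans of products. -/
theorem zero_component_eq_span (h : IsTripleEnvelope φ ι p e)
    (hinternal : DirectSum.IsInternal 𝒜)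
    (hmul : ∀ i j : ℤ, ∀ x ∈ 𝒜 i, ∀ y ∈ 𝒜 j, x * y ∈ 𝒜 (i + j))
    (hφgr : ∀ i : ℤ, Submodule.map φ (𝒜 i) = 𝒜 (-i))
    (hιrange : LinearMap.range ι = 𝒜 (-1)) :
    𝒜 0 = Submodule.span F (leftProducts φ ι ∪ rightProducts φ ι) := by
  have degj : ∀ x, ι x ∈ 𝒜 (-1) := fun x => hιrange ▸ ⟨x, rfl⟩
  have degs := star_mem_one hφgr hιrange
  have le : Submodule.span F (leftProducts φ ι ∪ rightProducts φ ι) ≤ 𝒜 0 := by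
    refine Submodule.span_le.2 ?_
    rintro _ (⟨x, y, rfl⟩ | ⟨x, y, rfl⟩)
    · simpa using hmul _ _ _ (degj x) _ (degs y)
    · simpa using hmul _ _ _ (degs x) _ (degj y)
  refine le_antisymm (fun c hc => ?_) le
  have hc' : ∃ x y, ∃ d ∈ Submodule.span F (leftProducts φ ι ∪ rightProducts φ ι),
      c = ι x + φ (ι y) + d := by
    clear hc
    induction c using h.induction with
    | hj x => exact ⟨x, 0, 0, zero_mem _, by simp⟩
    | hs x => exact ⟨0, x, 0, zero_mem _, by simp⟩
    | hl x y => exact ⟨0, 0, _, Submodule.subset_span (.inl ⟨x, y, rfl⟩), by simp⟩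
    | hr x y => exact ⟨0, 0, _, Submodule.subset_span (.inr ⟨x, y, rfl⟩), by simp⟩
    | hadd a b ha hb =>
      obtain ⟨x, y, d, hd, rfl⟩ := ha
      obtain ⟨x', y', d', hd', rfl⟩ := hb
      exact ⟨x + x', y + y', d + d', add_mem hd hd', by simp only [map_add]; abel⟩
    | hsmul t a ha =>
      obtain ⟨x, y, d, hd, rfl⟩ := ha
      exact ⟨t • x, t • y, t • d, Submodule.smul_mem _ t hd, by simp⟩
  obtain ⟨x, y, d, hd, rfl⟩ := hc'
  have h0 : ι x + φ (ι y) ∈ 𝒜 0 := by simpa using sub_mem hc (le hd)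
  have h1 : ι x + φ (ι y) ∈ ⨆ i ≠ (0 : ℤ), 𝒜 i :=
    add_mem (Submodule.mem_iSup_of_mem (-1) (Submodule.mem_iSup_of_mem (by decide) (degj x)))
      (Submodule.mem_iSup_of_mem 1 (Submodule.mem_iSup_of_mem (by decide) (degs y)))
  have h2 : ι x + φ (ι y) = 0 := by
    simpa using (hinternal.submodule_iSupIndep 0).le_bot ⟨h0, h1⟩
  rw [h2, zero_add]
  exact hd

end Graded

section BaseChangeGraded

variable {F A W R : Type*} [Field F] [Ring A] [Algebra F A] [AddCommGroup W] [Module F W]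
  [CommRing R] [Algebra F R] {φ : A →ₗ[F] A} {ι : W →ₗ[F] A}

theorem baseChange_range_eq : (LinearMap.range ι).baseChange R =
    LinearMap.range (ι.baseChange R) := by
  refine le_antisymm ?_ ?_
  · rw [Submodule.baseChange_eq_span]
    refine Submodule.span_le.2 ?_
    rintro _ ⟨_, ⟨x, rfl⟩, rfl⟩
    exact ⟨1 ⊗ₜ x, by simp⟩
  · rintro _ ⟨x, rfl⟩
    induction x using TensorProduct.induction_on with
    | zero => simp
    | add x y hx hy => rw [map_add]; exact add_mem hx hy
    | tmul r x => exact Submodule.tmul_mem_baseChange_of_mem r ⟨x, rfl⟩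

theorem baseChange_span_products :
    (Submodule.span F (leftProducts φ ι ∪ rightProducts φ ι)).baseChange R =
      Submodule.span R (leftProducts (φ.baseChange R) (ι.baseChange R) ∪
        rightProducts (φ.baseChange R) (ι.baseChange R)) := by
  refine le_antisymm ?_ (Submodule.span_le.2 ?_)
  · rw [Submodule.baseChange_span]
    refine Submodule.span_mono ?_
    rintro _ ⟨_, ⟨x, y, rfl⟩ | ⟨x, y, rfl⟩, rfl⟩
    · exact .inl ⟨1 ⊗ₜ x, 1 ⊗ₜ y, by simp⟩
    · exact .inr ⟨1 ⊗ₜ x, 1 ⊗ₜ y, by simp⟩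
  · rintro _ (⟨x, y, rfl⟩ | ⟨x, y, rfl⟩)
    all_goals
      induction x using TensorProduct.induction_on with
      | zero => simp
      | add x x' hx hx' => simp only [map_add, add_mul]; exact add_mem hx hx'
      | tmul r x =>
        induction y using TensorProduct.induction_on with
        | zero => simp
        | add y y' hy hy' => simp only [map_add, mul_add]; exact add_mem hy hy'
        | tmul s y =>
          simp only [LinearMap.baseChange_tmul, Algebra.TensorProduct.tmul_mul_tmul]
          refine Submodule.tmul_mem_baseChange_of_mem _ (Submodule.subset_span ?_)
          first | exact .inl ⟨x, y, rfl⟩ | exact .inr ⟨x, y, rfl⟩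

end BaseChangeGraded

section Extension

variable {R B M : Type*} [CommRing R] [Ring B] [Algebra R B] [AddCommGroup M] [Module R M]
  {φ : B →ₗ[R] B} {j : M →ₗ[R] B} {f : B ≃ₐ[R] B} {ψ : M ≃ₗ[R] M}

theorem map_range_eq (hf : ∀ x, f (j x) = j (ψ x)) :
    Submodule.map (f : B →ₗ[R] B) (LinearMap.range j) = LinearMap.range j := by
  ext b
  constructor
  · rintro ⟨_, ⟨x, rfl⟩, rfl⟩
    exact ⟨ψ x, (hf x).symm⟩
  · rintro ⟨x, rfl⟩
    exact ⟨j (ψ.symm x), ⟨_, rfl⟩, by simp [hf]⟩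

theorem map_products_eq (hf : ∀ x, f (j x) = j (ψ x)) (hφ : ∀ b, f (φ b) = φ (f b)) :
    Submodule.map (f : B →ₗ[R] B) (Submodule.span R (leftProducts φ j ∪ rightProducts φ j)) =
      Submodule.span R (leftProducts φ j ∪ rightProducts φ j) := by
  rw [Submodule.map_span]
  congr 1
  ext b
  constructor
  · rintro ⟨_, ⟨x, y, rfl⟩ | ⟨x, y, rfl⟩, rfl⟩
    · exact .inl ⟨ψ x, ψ y, by simp [hf, hφ]⟩
    · exact .inr ⟨ψ x, ψ y, by simp [hf, hφ]⟩
  · rintro (⟨x, y, rfl⟩ | ⟨x, y, rfl⟩)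
    · exact ⟨_, .inl ⟨ψ.symm x, ψ.symm y, rfl⟩, by simp [hf, hφ]⟩
    · exact ⟨_, .inr ⟨ψ.symm x, ψ.symm y, rfl⟩, by simp [hf, hφ]⟩

end Extension

end IsTripleEnvelope

/-!
STATEMENT 0. Let W be a simple finite-dimensional AT2 over a field F of characteristic ≠ 2 and
let (𝒜(W), φ, Γ(W)) be its Loos envelope.  Then the morphism of affine group schemes
θ : Aut(W,{·,·,·}) → Aut(𝒜(W),φ,Γ(W)), given on R-points by extending an automorphism ψ of
(W⊗R,{·,·,·}_R) to the automorphism 𝒜(ψ) of (𝒜(W)⊗R, φ_R, Γ(W)_R), is an isomorphism of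
affine group schemes, with inverse given by restriction to the degree (−1) component
𝒜(W)₋₁ ⊗ R = W ⊗ R.

The Loos envelope is characterized (up to isomorphism, by the results of Loos) as a simple
associative algebra with involution (A,φ) with a compatible 3-grading whose degree (−1)
component is the image of a triple-product preserving linear embedding ι of W.  The
isomorphism of affine group schemes is expressed on the groups of R-points (R any unital
commutative associative F-algebra; naturality of the restriction map in R is automatic): every
automorphism of (A⊗R, φ_R, Γ_R) restricts along ι to an automorphism of (W⊗R, {·,·,·}_R),
and every automorphism of (W⊗R,{·,·,·}_R) admits a unique extension to an automorphism of
(A⊗R, φ_R, Γ_R); that is, restriction is bijective, its inverse being θ on R-points.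
-/

theorem stmt_0.{v}
    (F : Type*) [Field F] (hchar : ringChar F ≠ 2)
    -- the AT2 (W,p), finite-dimensional and simple
    (W : Type*) [AddCommGroup W] [Module F W] [FiniteDimensional F W]
    (p : W →ₗ[F] W →ₗ[F] W →ₗ[F] W)
    (hAT2a : ∀ u v x y z : W, p (p u v x) y z = p u (p y x v) z)
    (hAT2b : ∀ u v x y z : W, p (p u v x) y z = p u v (p x y z))
    (hWne : ∃ x y z : W, p x y z ≠ 0)
    (hWsimple : ∀ I : Submodule F W,
      (∀ a ∈ I, ∀ y z : W, p a y z ∈ I ∧ p y a z ∈ I ∧ p y z a ∈ I) → I = ⊥ ∨ I = ⊤)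
    -- the Loos envelope (A,φ,Γ(W)) of W
    (A : Type*) [Ring A] [Algebra F A]
    (φ : A →ₗ[F] A)
    (hφ₂ : ∀ a, φ (φ a) = a)
    (hφmul : ∀ a b, φ (a * b) = φ b * φ a)
    (hA2 : ∃ a b : A, a * b ≠ 0)
    (hsimple : ∀ I : Submodule F A,
      (∀ a : A, ∀ x ∈ I, a * x ∈ I ∧ x * a ∈ I) → (∀ x ∈ I, φ x ∈ I) →
      I = ⊥ ∨ I = ⊤)
    (𝒜 : ℤ → Submodule F A)
    (hinternal : DirectSum.IsInternal 𝒜)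
    (hsupp : ∀ i : ℤ, i ≠ -1 → i ≠ 0 → i ≠ 1 → 𝒜 i = ⊥)
    (hmul : ∀ i j : ℤ, ∀ x ∈ 𝒜 i, ∀ y ∈ 𝒜 j, x * y ∈ 𝒜 (i + j))
    (hφgr : ∀ i : ℤ, Submodule.map φ (𝒜 i) = 𝒜 (-i))
    -- the canonical identification of W with the degree (−1) component, under which the triple
    -- product of W becomes {x,y,z} = xφ(y)z
    (ι : W →ₗ[F] A)
    (hιinj : Function.Injective ι)
    (hιrange : LinearMap.range ι = 𝒜 (-1))
    (hιtriple : ∀ x y z : W, ι (p x y z) = ι x * φ (ι y) * ι z) :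
    -- conclusion: for every R-point (R a unital commutative associative F-algebra)
    ∀ (R : Type v) [CommRing R] [Algebra F R],
    -- ... and for the R-trilinear scalar extension of the triple product of W ...
    ∀ pR : (R ⊗[F] W) →ₗ[R] (R ⊗[F] W) →ₗ[R] (R ⊗[F] W) →ₗ[R] (R ⊗[F] W),
      (∀ x y z : W,
        pR ((1 : R) ⊗ₜ[F] x) ((1 : R) ⊗ₜ[F] y) ((1 : R) ⊗ₜ[F] z) = (1 : R) ⊗ₜ[F] p x y z) →
      -- (a) every automorphism of (𝒜(W)⊗R, φ_R, Γ_R) restricts along ι to an automorphism of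
      --     (W⊗R, {·,·,·}_R)  [so θ⁻¹, restriction, is well defined and surjects onto the
      --     image of θ];
      (∀ Ψ : (R ⊗[F] A) ≃ₐ[R] (R ⊗[F] A),
        (∀ x : R ⊗[F] A, Ψ (φ.baseChange R x) = φ.baseChange R (Ψ x)) →
        (∀ i : ℤ, Submodule.map (Ψ : (R ⊗[F] A) →ₗ[R] (R ⊗[F] A)) ((𝒜 i).baseChange R)
            = (𝒜 i).baseChange R) →
        ∃ ψ : (R ⊗[F] W) ≃ₗ[R] (R ⊗[F] W),
          (∀ x y z : R ⊗[F] W, ψ (pR x y z) = pR (ψ x) (ψ y) (ψ z)) ∧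
          (∀ w : R ⊗[F] W, Ψ (ι.baseChange R w) = ι.baseChange R (ψ w))) ∧
      -- (b) every automorphism ψ of (W⊗R, {·,·,·}_R) has a unique extension 𝒜(ψ) to an
      --     automorphism of (𝒜(W)⊗R, φ_R, Γ_R)  [so θ : ψ ↦ 𝒜(ψ) is well defined and is a
      --     two-sided inverse of restriction; multiplicativity of both maps is immediate from
      --     the characterizing property, and naturality in R is automatic]
      (∀ ψ : (R ⊗[F] W) ≃ₗ[R] (R ⊗[F] W),
        (∀ x y z : R ⊗[F] W, ψ (pR x y z) = pR (ψ x) (ψ y) (ψ z)) →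
        ∃! Ψ : (R ⊗[F] A) ≃ₐ[R] (R ⊗[F] A),
          (∀ x : R ⊗[F] A, Ψ (φ.baseChange R x) = φ.baseChange R (Ψ x)) ∧
          (∀ i : ℤ, Submodule.map (Ψ : (R ⊗[F] A) →ₗ[R] (R ⊗[F] A)) ((𝒜 i).baseChange R)
              = (𝒜 i).baseChange R) ∧
          (∀ w : R ⊗[F] W, Ψ (ι.baseChange R w) = ι.baseChange R (ψ w))) := by
  intro R _ _ pR hpR
  have hι : ι ≠ 0 := by
    rintro rfl
    obtain ⟨x, y, z, hxyz⟩ := hWne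
    exact hxyz (hιinj (by simp))
  obtain ⟨e, he⟩ := IsTripleEnvelope.exists_of_graded hφ₂ hφmul hsimple hinternal hsupp hmul hφgr
    hιinj hιrange hι hιtriple
  have hR := he.baseChange pR hpR
  have gr_neg : (𝒜 (-1)).baseChange R = LinearMap.range (ι.baseChange R) := by
    rw [← hιrange, IsTripleEnvelope.baseChange_range_eq]
  refine ⟨fun Ψ hΨ hgr => ?_, fun ψ hψ => ?_⟩
  · have hmap := hgr (-1)
    rw [gr_neg] at hmap
    let i := LinearEquiv.ofInjective (ι.baseChange R) hR.inj
    let ψ := i ≪≫ₗ (Ψ.toLinearEquiv.submoduleMap (LinearMap.range (ι.baseChange R))) ≪≫ₗ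
      LinearEquiv.ofEq _ _ hmap ≪≫ₗ i.symm
    have hψ : ∀ w, Ψ (ι.baseChange R w) = ι.baseChange R (ψ w) := fun w => by
      have : i (ψ w) = LinearEquiv.ofEq _ _ hmap (Ψ.toLinearEquiv.submoduleMap
        (LinearMap.range (ι.baseChange R)) (i w)) := i.apply_symm_apply _
      exact (congrArg Subtype.val this).symm
    refine ⟨ψ, fun x y z => hR.inj ?_, hψ⟩
    rw [← hψ, hR.triple, hR.triple, map_mul, map_mul, hΨ, hψ, hψ, hψ]
  · obtain ⟨f, hf, hf'⟩ := hR.exists_algEquiv ψ hψ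
    refine ⟨f, ⟨hf', fun i => ?_, hf⟩, fun g ⟨hg', _, hg⟩ => ?_⟩
    · by_cases h1 : i = -1
      · rw [h1, gr_neg, IsTripleEnvelope.map_range_eq hf]
      by_cases h2 : i = 0
      · rw [h2, IsTripleEnvelope.zero_component_eq_span he hinternal hmul hφgr hιrange,
          IsTripleEnvelope.baseChange_span_products, IsTripleEnvelope.map_products_eq hf hf']
      by_cases h3 : i = 1
      · have h4 : 𝒜 1 = LinearMap.range (φ ∘ₗ ι) := by
          rw [LinearMap.range_comp, hιrange, hφgr, neg_neg]
        rw [h3, h4, IsTripleEnvelope.baseChange_range_eq]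
        refine IsTripleEnvelope.map_range_eq (ψ := ψ) fun x => ?_
        rw [LinearMap.baseChange_comp, LinearMap.comp_apply, hf', hf, LinearMap.comp_apply]
      rw [hsupp i h1 h2 h3, Submodule.baseChange_bot, Submodule.map_bot]
    · exact AlgEquiv.coe_toAlgHom_injective (hR.algHom_ext (f := g.toAlgHom) (g := f.toAlgHom)
        hg' hf' fun x => (hg x).trans (hf x).symm)
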